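/- arXiv:2302.12305 — 4 statements merged into one kernel-verified Lean document; each statement's English description precedes it below -/
import Mathlib

section
/- Let k and ω be integers with 1 ≤ ω ≤ k. For a ∈ ZMod k let I_a = {a, a+1, …, a+ω−1} ⊆ ZMod k be the cyclic interval of length ω starting at a. Then for every nonempty finite subset S ⊆ ZMod k, the union ⋃_{a∈S} I_a has cardinality at least min(ω + |S| − 1, k). -/
/-- The cyclic interval `{a, a+1, …, a+ω−1}` of length `ω` starting at `a` in `ZMod k`. -/
def Icyc (k ω : ℕ) (a : ZMod k) : Finset (ZMod k) :=
  (Finset.range ω).image (fun j : ℕ => a + (j : ZMod k))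

theorem mem_Icyc {k ω : ℕ} {a x : ZMod k} : x ∈ Icyc k ω a ↔ ∃ j < ω, a + (j : ZMod k) = x := by
  simp [Icyc]

theorem Icyc_subset_succ (k ω : ℕ) (a : ZMod k) : Icyc k ω a ⊆ Icyc k (ω + 1) a :=
  Finset.image_subset_image (Finset.range_subset_range.2 ω.le_succ)

theorem add_one_mem_Icyc_succ {k ω : ℕ} {a x : ZMod k} (hx : x ∈ Icyc k ω a) :
    x + 1 ∈ Icyc k (ω + 1) a := by
  obtain ⟨j, hj, rfl⟩ := mem_Icyc.1 hx
  exact mem_Icyc.2 ⟨j + 1, by omega, by push_cast; ring⟩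

/-- A nonempty subset of `ZMod k` that is stable under `x ↦ x + 1` has `k` elements. -/
theorem ZMod.card_eq_of_add_one_mem {k : ℕ} [NeZero k] {U : Finset (ZMod k)} (hU : U.Nonempty)
    (h : ∀ x ∈ U, x + 1 ∈ U) : U.card = k := by
  obtain ⟨x, hx⟩ := hU
  have hn (n : ℕ) : x + (n : ZMod k) ∈ U := by
    induction n with
    | zero => simpa using hx
    | succ n ih => simpa [add_assoc] using h _ ih
  have huniv : U = Finset.univ := by
    ext y
    simpa using hn (y - x).val
  rw [huniv, Finset.card_univ, ZMod.card]

theorem min_le_card_biUnion_Icyc_succ (k n : ℕ) [NeZero k] (S : Finset (ZMod k))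
    (hS : S.Nonempty) : min (n + S.card) k ≤ (S.biUnion (fun a => Icyc k (n + 1) a)).card := by
  induction n with
  | zero => simp [Icyc]
  | succ n ih =>
    have hsub : S.biUnion (fun a => Icyc k (n + 1) a) ⊆ S.biUnion (fun a => Icyc k (n + 1 + 1) a) :=
      Finset.biUnion_mono fun a _ => Icyc_subset_succ k (n + 1) a
    by_cases h : ∀ x ∈ S.biUnion (fun a => Icyc k (n + 1) a),
        x + 1 ∈ S.biUnion (fun a => Icyc k (n + 1) a)
    · have hne : (S.biUnion (fun a => Icyc k (n + 1) a)).Nonempty :=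
        hS.biUnion fun a _ => ⟨a, mem_Icyc.2 ⟨0, by omega, by simp⟩⟩
      have hcard := ZMod.card_eq_of_add_one_mem hne h
      have hle := Finset.card_le_card hsub
      omega
    · push Not at h
      obtain ⟨x, hx, hx1⟩ := h
      obtain ⟨a, ha, hxa⟩ := Finset.mem_biUnion.1 hx
      have hlt := Finset.card_lt_card (Finset.ssubset_iff_subset_ne.2 ⟨hsub, fun he =>
        hx1 (he ▸ Finset.mem_biUnion.2 ⟨a, ha, add_one_mem_Icyc_succ hxa⟩)⟩)
      omega

/-- For `1 ≤ ω ≤ k` and any nonempty finite `S ⊆ ZMod k`, the union of the cyclic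
intervals of length `ω` starting at the elements of `S` has cardinality at least
`min (ω + |S| − 1) k`. -/
theorem union_cyclic_intervals_card_ge (k ω : ℕ) (hω : 1 ≤ ω) (hωk : ω ≤ k)
    (S : Finset (ZMod k)) (hS : S.Nonempty) :
    min (ω + S.card - 1) k ≤ (S.biUnion (fun a => Icyc k ω a)).card := by
  have : NeZero k := ⟨by omega⟩
  obtain ⟨n, rfl⟩ := Nat.exists_eq_add_of_le' hω
  have h := min_le_card_biUnion_Icyc_succ k n S hS
  rwa [show n + 1 + S.card - 1 = n + S.card by omega]
end

section
/- (Case 2 of Theorem 1.) For every subset C ⊆ Fin n with |C| = m where 2s < m ≤ k_A, the neighborhood ⋃_{c∈C} T_c has cardinality at least min(ω_A + s + (m − 2s) − 1, k_A) = min(m, k_A) = m. -/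
/-- The support assignment of Algorithm 1: client `i < k_A` gets the cyclic interval of
length `ω_A = s+1` starting at `i`, and passive client `k_A + j` gets the one starting
at `j`. -/
def Tsup (kA s : ℕ) (c : Fin (kA + s)) : Finset (ZMod kA) :=
  if (c : ℕ) < kA then Icyc kA (s + 1) ((c : ℕ) : ZMod kA)
  else Icyc kA (s + 1) (((c : ℕ) - kA : ℕ) : ZMod kA)

theorem Tsup_eq_Icyc (kA s : ℕ) (c : Fin (kA + s)) :
    Tsup kA s c = Icyc kA (s + 1) ((c : ℕ) : ZMod kA) := by
  unfold Tsup
  split_ifs with h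
  · rfl
  · rw [Nat.cast_sub (not_lt.mp h), ZMod.natCast_self, sub_zero]

/-- A nonempty subset of `ZMod k` closed under adding `1` is everything. -/
theorem ZMod.eq_univ_of_add_one_mem {k : ℕ} [NeZero k] {X : Finset (ZMod k)}
    (hX : X.Nonempty) (h : ∀ x ∈ X, x + 1 ∈ X) : X = Finset.univ := by
  obtain ⟨a, ha⟩ := hX
  have key : ∀ n : ℕ, a + (n : ZMod k) ∈ X := by
    intro n
    induction n with
    | zero => simpa using ha
    | succ n ih => simpa [add_assoc] using h _ ih
  refine Finset.eq_univ_of_forall fun x => ?_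
  simpa using key (x - a).val

theorem min_card_add_le_card_biUnion_Icyc {k : ℕ} [NeZero k] {S : Finset (ZMod k)}
    (hS : S.Nonempty) (w : ℕ) : min (S.card + w) k ≤ (S.biUnion (Icyc k (w + 1))).card := by
  induction w with
  | zero =>
    refine (min_le_left _ _).trans (Finset.card_le_card fun a ha => ?_)
    exact Finset.mem_biUnion.mpr ⟨a, ha, mem_Icyc.mpr ⟨0, by simp⟩⟩
  | succ w ih =>
    have hsub : S.biUnion (Icyc k (w + 1)) ⊆ S.biUnion (Icyc k (w + 1 + 1)) := by
      intro x hx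
      obtain ⟨a, ha, hx⟩ := Finset.mem_biUnion.mp hx
      obtain ⟨j, hj, rfl⟩ := mem_Icyc.mp hx
      exact Finset.mem_biUnion.mpr ⟨a, ha, mem_Icyc.mpr ⟨j, by omega, rfl⟩⟩
    have hne : (S.biUnion (Icyc k (w + 1))).Nonempty := by
      obtain ⟨a, ha⟩ := hS
      exact ⟨a, Finset.mem_biUnion.mpr ⟨a, ha, mem_Icyc.mpr ⟨0, by simp⟩⟩⟩
    by_cases heq : S.biUnion (Icyc k (w + 1)) = S.biUnion (Icyc k (w + 1 + 1))
    · have huniv : S.biUnion (Icyc k (w + 1)) = Finset.univ := by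
        refine ZMod.eq_univ_of_add_one_mem hne fun x hx => ?_
        obtain ⟨a, ha, hx⟩ := Finset.mem_biUnion.mp hx
        obtain ⟨j, hj, rfl⟩ := mem_Icyc.mp hx
        rw [heq]
        exact Finset.mem_biUnion.mpr
          ⟨a, ha, mem_Icyc.mpr ⟨j + 1, by omega, by push_cast; ring⟩⟩
      rw [← heq, huniv, Finset.card_univ, ZMod.card]
      exact min_le_right _ _
    · have hlt := Finset.card_lt_card (hsub.ssubset_of_ne heq)
      omega

/-- Reduction mod `k` collapses at most `s` elements of a subset of `Fin (k + s)`. -/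
theorem card_le_card_image_natCast_add (k s : ℕ) (C : Finset (Fin (k + s))) :
    C.card ≤ (C.image fun c : Fin (k + s) => ((c : ℕ) : ZMod k)).card + s := by
  rw [← Finset.card_filter_add_card_filter_not (s := C) (fun c => (c : ℕ) < k)]
  refine add_le_add ?_ ?_
  · refine Finset.card_le_card_of_injOn (fun c => ((c : ℕ) : ZMod k)) ?_ ?_
    · intro c hc
      exact Finset.mem_image_of_mem _ (Finset.mem_of_mem_filter c hc)
    · intro c hc d hd hcd
      have hck : (c : ℕ) < k := (Finset.mem_filter.mp hc).2
      have hdk : (d : ℕ) < k := (Finset.mem_filter.mp hd).2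
      have hmod := (ZMod.natCast_eq_natCast_iff' _ _ k).mp hcd
      rw [Nat.mod_eq_of_lt hck, Nat.mod_eq_of_lt hdk] at hmod
      exact Fin.ext hmod
  · calc _ ≤ (Finset.Ico k (k + s)).card := by
          refine Finset.card_le_card_of_injOn (fun c => (c : ℕ)) ?_ Fin.val_injective.injOn
          intro c hc
          exact Finset.mem_Ico.mpr ⟨not_lt.mp (Finset.mem_filter.mp hc).2, c.isLt⟩
      _ = s := by simp

/-- Case 2 of Theorem 1: for `C` with `|C| = m`, `2s < m ≤ k_A`, the neighborhood
`⋃_{c∈C} T_c` has cardinality at least `min (ω_A + s + (m − 2s) − 1) k_A = min m k_A = m`. -/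
theorem hall_case_two (kA s : ℕ) (hs : 1 ≤ s) (hsk : s < kA)
    (C : Finset (Fin (kA + s))) (hm1 : 2 * s < C.card) (hm2 : C.card ≤ kA) :
    min ((s + 1) + s + (C.card - 2 * s) - 1) kA ≤ (C.biUnion (Tsup kA s)).card ∧
    min ((s + 1) + s + (C.card - 2 * s) - 1) kA = min C.card kA ∧
    min C.card kA = C.card := by
  have hk : NeZero kA := ⟨by omega⟩
  have himg := card_le_card_image_natCast_add kA s C
  have hne : (C.image fun c : Fin (kA + s) => ((c : ℕ) : ZMod kA)).Nonempty :=
    Finset.card_pos.mp (by omega)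
  have hbound := min_card_add_le_card_biUnion_Icyc hne s
  have hunion : C.biUnion (Tsup kA s) =
      (C.image fun c : Fin (kA + s) => ((c : ℕ) : ZMod kA)).biUnion (Icyc kA (s + 1)) := by
    rw [Finset.image_biUnion]
    exact Finset.biUnion_congr rfl fun c _ => Tsup_eq_Icyc kA s c
  rw [hunion]
  omega
end

section
/- (General support-to-coefficients theorem.) Let k ≤ n be positive integers and let T : Fin n → Finset (Fin k) be a support assignment such that for every subset C ⊆ Fin n with |C| = k there exists a bijection f : C → Fin k with f(c) ∈ T(c) for all c ∈ C. Then there exist coefficient vectors v : Fin n → (Fin k → ℝ) with v i q = 0 whenever q ∉ T(i), such that for every subset C ⊆ Fin n with |C| = k, the k × k matrix whose rows are (v c)_{c∈C} is invertible. -/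
/-- A finite family of nonzero polynomials over an infinite domain has a common point of non-vanishing. -/
theorem MvPolynomial.exists_forall_eval_ne_zero {R σ ι : Type*} [CommRing R] [IsDomain R]
    [Infinite R] [Fintype ι] (p : ι → MvPolynomial σ R) (hp : ∀ i, p i ≠ 0) :
    ∃ x : σ → R, ∀ i, MvPolynomial.eval x (p i) ≠ 0 := by
  by_contra! h
  refine Finset.prod_ne_zero_iff.mpr (fun i _ => hp i) (MvPolynomial.funext (p := ∏ i, p i)
    (q := 0) fun x => ?_)
  obtain ⟨i, hi⟩ := h x
  rw [map_prod, map_zero]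
  exact Finset.prod_eq_zero (Finset.mem_univ i) hi

/-- The generic matrix whose `i`-th row is supported on `T i`. -/
noncomputable def genericSupported {m q : Type*} (R : Type*) [CommRing R] [DecidableEq q]
    (T : m → Finset q) : Matrix m q (MvPolynomial (m × q) R) :=
  Matrix.of fun i j => if j ∈ T i then MvPolynomial.X (i, j) else 0

theorem eval_det_submatrix_genericSupported {m q R : Type*} [CommRing R] [DecidableEq q]
    [Fintype q] (T : m → Finset q) (e : q → m) (x : m × q → R) :
    MvPolynomial.eval x ((genericSupported R T).submatrix e id).det =
      (Matrix.of fun r j => if j ∈ T (e r) then x (e r, j) else 0).det := by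
  rw [RingHom.map_det]
  congr 1
  ext r j
  simp only [RingHom.mapMatrix_apply, Matrix.map_apply, Matrix.submatrix_apply, genericSupported,
    Matrix.of_apply, id_eq]
  split_ifs <;> simp

/-- A transversal of the supports of the selected rows makes the generic minor nonzero. -/
theorem det_submatrix_genericSupported_ne_zero {m q R : Type*} [CommRing R] [Nontrivial R]
    [DecidableEq q] [Fintype q] (T : m → Finset q) {e : q → m} (he : e.Injective)
    (σ : Equiv.Perm q) (hσ : ∀ r, σ r ∈ T (e r)) :
    ((genericSupported R T).submatrix e id).det ≠ 0 := by
  classical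
  intro h
  have h' := congrArg
    (MvPolynomial.eval fun p : m × q => if ∃ r, e r = p.1 ∧ σ r = p.2 then (1 : R) else 0) h
  rw [eval_det_submatrix_genericSupported, map_zero] at h'
  have hM : (Matrix.of fun r j => if j ∈ T (e r) then
      (if ∃ r', e r' = e r ∧ σ r' = j then (1 : R) else 0) else 0) =
      (1 : Matrix q q R).submatrix σ id := by
    ext r j
    have := hσ r
    simp only [he.eq_iff, exists_eq_left, Matrix.of_apply, Matrix.submatrix_apply, id_eq,
      Matrix.one_apply]
    split_ifs <;> simp_all
  rw [hM, Matrix.det_permute, Matrix.det_one, mul_one] at h'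
  exact ((Equiv.Perm.sign σ).isUnit.map (Int.castRingHom R)).ne_zero h'

/-- General support-to-coefficients theorem: if every `k`-subset of clients admits a
system of distinct representatives for the support assignment `T`, then there are
coefficient vectors respecting the support such that every `k × k` subsystem matrix
(rows indexed by a `k`-subset `C` of clients) is invertible. -/
theorem support_to_coefficients (k n : ℕ) (hk : 0 < k) (hkn : k ≤ n)
    (T : Fin n → Finset (Fin k))
    (hall : ∀ C : Finset (Fin n), C.card = k →
      ∃ f : {c // c ∈ C} → Fin k, Function.Bijective f ∧
        ∀ c : {c // c ∈ C}, f c ∈ T c.1) :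
    ∃ v : Fin n → Fin k → ℝ,
      (∀ i q, q ∉ T i → v i q = 0) ∧
      ∀ (C : Finset (Fin n)) (hC : C.card = k),
        IsUnit (Matrix.of fun (r q : Fin k) => v (C.orderIsoOfFin hC r) q) := by
  obtain ⟨x, hx⟩ := MvPolynomial.exists_forall_eval_ne_zero
    (fun C : {C : Finset (Fin n) // C.card = k} =>
      ((genericSupported ℝ T).submatrix (fun r => (C.1.orderIsoOfFin C.2 r : Fin n)) id).det)
    (by
      rintro ⟨C, hC⟩
      obtain ⟨f, hf, hfT⟩ := hall C hC
      exact det_submatrix_genericSupported_ne_zero T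
        (Subtype.val_injective.comp (C.orderIsoOfFin hC).injective)
        ((C.orderIsoOfFin hC).toEquiv.trans (Equiv.ofBijective f hf)) fun r => hfT _)
  refine ⟨fun i q => if q ∈ T i then x (i, q) else 0, fun i q hq => if_neg hq, fun C hC => ?_⟩
  rw [Matrix.isUnit_iff_isUnit_det, isUnit_iff_ne_zero]
  have h := hx ⟨C, hC⟩
  rwa [eval_det_submatrix_genericSupported] at h
end

section
/- (Theorem 2(b): heterogeneous resilience.) Let k_A' and s' be positive integers (numbers of active and passive real clients), n' = k_A' + s', and let c : Fin n' → ℕ be positive capacities. Set k̄ = Σ_{i < k_A'} c(i) and s̄ = Σ_{k_A' ≤ i < n'} c(i), and assume 1 ≤ s̄ < k̄. Identify the virtual clients with Fin (k̄ + s̄) by assigning to real client i the block of c(i) consecutive virtual indices (active clients first, then passive clients), and let v : Fin (k̄ + s̄) → (ZMod k̄ → ℝ) be coefficient vectors as produced by Theorem 1 for parameters (k̄, s̄), i.e., supported on the cyclic-interval support assignment with ω = s̄ + 1 and such that every k̄-subset of rows forms an invertible matrix. Then for every straggler set S ⊆ Fin n' of real clients with Σ_{i∈S} c(i) ≤ s̄,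 there exists a subset C of size k̄ of virtual clients, all belonging to real clients outside S, such that the k̄ × k̄ matrix with rows (v c)_{c∈C} is invertible; hence the heterogeneous system recovers Aᵀx from the non-straggler clients. -/
/-- The number of virtual clients preceding real client `i`: the sum of the capacities
of the real clients with smaller index. Real client `i` owns the virtual indices `w`
with `pfx n' c i ≤ w < pfx n' c i + c i`. -/
def pfx (n' : ℕ) (c : Fin n' → ℕ) (i : Fin n') : ℕ :=
  ∑ j ∈ Finset.univ.filter (fun j : Fin n' => (j : ℕ) < (i : ℕ)), c j

/-- Every virtual index below the total capacity lies in the block of some real client. -/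
lemma exists_mem_block {n : ℕ} (c : Fin n → ℕ) {w : ℕ} (hw : w < ∑ i, c i) :
    ∃ i, pfx n c i ≤ w ∧ w < pfx n c i + c i := by
  by_contra! h
  have key : ∀ m ≤ n, ∑ j ∈ Finset.univ.filter (fun j : Fin n => (j : ℕ) < m), c j ≤ w := by
    intro m
    induction m with
    | zero => simp
    | succ m ih =>
      intro hm
      have hfilter : Finset.univ.filter (fun j : Fin n => (j : ℕ) < m + 1) =
          insert ⟨m, hm⟩ (Finset.univ.filter (fun j : Fin n => (j : ℕ) < m)) := by
        ext j
        simp only [Finset.mem_filter_univ, Finset.mem_insert, Fin.ext_iff]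
        omega
      rw [hfilter, Finset.sum_insert (by simp), add_comm]
      exact h ⟨m, hm⟩ (ih (by omega))
  have := key n le_rfl
  simp only [Fin.is_lt, Finset.filter_true] at this
  omega

/-- The virtual clients owned by a set `S` of real clients number at most the total capacity
of `S`. -/
lemma card_blocks_le {n : ℕ} (c : Fin n → ℕ) (S : Finset (Fin n)) (m : ℕ) :
    (S.biUnion fun i => Finset.univ.filter
      (fun w : Fin m => pfx n c i ≤ w ∧ (w : ℕ) < pfx n c i + c i)).card ≤ ∑ i ∈ S, c i := by
  refine Finset.card_biUnion_le.trans (Finset.sum_le_sum fun i _ => ?_)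
  calc _ ≤ (Finset.Ico (pfx n c i) (pfx n c i + c i)).card :=
        Finset.card_le_card_of_injOn (fun w : Fin m => (w : ℕ))
          (fun w hw => by simpa using hw) Fin.val_injective.injOn
    _ = c i := by simp

/-- Theorem 2(b), heterogeneous resilience: with `kbar` (resp. `sbar`) the total
capacity of the active (resp. passive) real clients, and `v` coefficient vectors as
produced by Theorem 1 for the homogeneous system of `kbar + sbar` virtual clients
(supported on the cyclic-interval assignment, every `kbar`-subset of rows invertible),
for every straggler set `S` of real clients of total capacity at most `sbar` there is a
set `C` of `kbar` virtual clients, all owned by real clients outside `S`, whose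
coefficient matrix is invertible; hence the heterogeneous system recovers `Aᵀx` from
the non-straggler clients. -/
theorem heterogeneous_resilience (kA' s' : ℕ) (hkA' : 0 < kA') (hs' : 0 < s')
    (c : Fin (kA' + s') → ℕ) (hc : ∀ i, 0 < c i)
    (kbar sbar : ℕ)
    (hkbar : kbar = ∑ i ∈ Finset.univ.filter (fun i : Fin (kA' + s') => (i : ℕ) < kA'), c i)
    (hsbar : sbar = ∑ i ∈ Finset.univ.filter (fun i : Fin (kA' + s') => kA' ≤ (i : ℕ)), c i)
    (hs : 1 ≤ sbar) (hsk : sbar < kbar) [NeZero kbar]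
    (v : Fin (kbar + sbar) → ZMod kbar → ℝ)
    (hsupp : ∀ w q, q ∉ Tsup kbar sbar w → v w q = 0)
    (hinv : ∀ C : Finset (Fin (kbar + sbar)), C.card = kbar →
      ∃ N : Matrix (ZMod kbar) {w // w ∈ C} ℝ,
        (Matrix.of fun (w : {w // w ∈ C}) (q : ZMod kbar) => v w.1 q) * N = 1 ∧
        N * (Matrix.of fun (w : {w // w ∈ C}) (q : ZMod kbar) => v w.1 q) = 1)
    (S : Finset (Fin (kA' + s'))) (hS : ∑ i ∈ S, c i ≤ sbar) :
    ∃ C : Finset (Fin (kbar + sbar)), C.card = kbar ∧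
      (∀ w ∈ C, ∃ i : Fin (kA' + s'), i ∉ S ∧
        pfx (kA' + s') c i ≤ (w : ℕ) ∧ (w : ℕ) < pfx (kA' + s') c i + c i) ∧
      ∃ N : Matrix (ZMod kbar) {w // w ∈ C} ℝ,
        (Matrix.of fun (w : {w // w ∈ C}) (q : ZMod kbar) => v w.1 q) * N = 1 ∧
        N * (Matrix.of fun (w : {w // w ∈ C}) (q : ZMod kbar) => v w.1 q) = 1 := by
  have htotal : ∑ i, c i = kbar + sbar := by
    rw [hkbar, hsbar, ← Finset.sum_filter_add_sum_filter_not Finset.univ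
      (fun i : Fin (kA' + s') => (i : ℕ) < kA')]
    simp only [not_lt]
  set B : Finset (Fin (kbar + sbar)) := S.biUnion fun i => Finset.univ.filter
    (fun w => pfx (kA' + s') c i ≤ w ∧ (w : ℕ) < pfx (kA' + s') c i + c i)
  have hBcard : B.card ≤ sbar := (card_blocks_le c S _).trans hS
  have hcompl : kbar ≤ Bᶜ.card := by
    rw [Finset.card_compl, Fintype.card_fin]
    omega
  obtain ⟨C, hCB, hC⟩ := Finset.exists_subset_card_eq hcompl
  refine ⟨C, hC, fun w hw => ?_, hinv C hC⟩
  obtain ⟨i, hi⟩ := exists_mem_block c (w.isLt.trans_eq htotal.symm)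
  refine ⟨i, fun hiS => Finset.mem_compl.1 (hCB hw) ?_, hi⟩
  exact Finset.mem_biUnion.2 ⟨i, hiS, Finset.mem_filter.2 ⟨Finset.mem_univ w, hi⟩⟩
end
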